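/- arXiv:1309.7118 — 2 statements merged into one kernel-verified Lean document; each statement's English description precedes it below -/
import Mathlib

section
/- Assume condition (G) for some γ ∈ ℕ, d > 0 and L > 0. Let 0 ≤ K < L with [K]+1 ≤ γ, 1 ≤ q ≤ ∞, and let f be a measurable function on ℝ^N × (0,∞) such that E_{K,q}[f] ∈ L^∞(0,T) for every T > 0. Then for any ℓ ∈ [0,K] there exists a constant C such that t^{(N/d)(1−1/q)} ‖P_K(t)f(·,t)‖_q + (1+t)^{−ℓ/d} |||P_K(t)f(·,t)|||_ℓ ≤ C (1+t)^{−K/d} E_{K,q}[f](t) for almost all t > 0. -/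
open MeasureTheory Filter Asymptotics Topology
open scoped ENNReal BigOperators

noncomputable section

/-- Partial derivative in the `i`-th coordinate direction. -/
def pderivE (N : ℕ) (i : Fin N) (f : EuclideanSpace ℝ (Fin N) → ℝ) :
    EuclideanSpace ℝ (Fin N) → ℝ :=
  fun x => fderiv ℝ f x (EuclideanSpace.single i 1)

/-- Multi-index partial derivative `∂_x^α`. -/
def mderivE (N : ℕ) (α : Fin N → ℕ) (f : EuclideanSpace ℝ (Fin N) → ℝ) :
    EuclideanSpace ℝ (Fin N) → ℝ :=
  (List.ofFn fun i : Fin N => (pderivE N i)^[α i]).foldr (fun T h => T h) f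

/-- `x ^ α` for a multi-index `α`. -/
def mpowE (N : ℕ) (α : Fin N → ℕ) (x : EuclideanSpace ℝ (Fin N)) : ℝ :=
  ∏ i, x i ^ α i

/-- `α !` for a multi-index `α`. -/
def mfactE (N : ℕ) (α : Fin N → ℕ) : ℕ := ∏ i, Nat.factorial (α i)

/-- `g_α(x,t) := ((-1)^{|α|}/α!) ∂_x^α G(x, t+1)`. -/
def gA (N : ℕ) (G : EuclideanSpace ℝ (Fin N) → ℝ → ℝ) (α : Fin N → ℕ)
    (x : EuclideanSpace ℝ (Fin N)) (t : ℝ) : ℝ :=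
  ((-1 : ℝ) ^ (∑ i, α i) / (mfactE N α : ℝ)) * mderivE N α (fun y => G y (t + 1)) x

/-- Condition (G) for the kernel `G` with parameters `γ`, `d`, `L`. -/
structure CondG (N : ℕ) (G : EuclideanSpace ℝ (Fin N) → ℝ → ℝ) (γ : ℕ) (d L : ℝ) : Prop where
  smooth : ContDiffOn ℝ γ (fun p : EuclideanSpace ℝ (Fin N) × ℝ => G p.1 p.2) {p | 0 < p.2}
  scaling : ∀ x : EuclideanSpace ℝ (Fin N), ∀ t : ℝ, 0 < t →
      G x t = t ^ (-(N : ℝ) / d) * G ((t ^ (-(1 : ℝ) / d)) • x) 1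
  decay : ∀ j : ℕ, j ≤ γ → ∃ C : ℝ, ∀ x : EuclideanSpace ℝ (Fin N),
      (1 + ‖x‖) ^ ((N : ℝ) + L + j) * ‖iteratedFDeriv ℝ j (fun y => G y 1) x‖ ≤ C
  semigroup : ∀ x : EuclideanSpace ℝ (Fin N), ∀ t s : ℝ, 0 < s → s < t →
      G x t = ∫ y, G (x - y) (t - s) * G y s

/-- `(e^{tℒ}φ)(x) = ∫ G(x-y,t) φ(y) dy`. -/
def sgOp (N : ℕ) (G : EuclideanSpace ℝ (Fin N) → ℝ → ℝ) (t : ℝ)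
    (φ : EuclideanSpace ℝ (Fin N) → ℝ) : EuclideanSpace ℝ (Fin N) → ℝ :=
  fun x => ∫ y, G (x - y) t * φ y

/-- `∫ x^α f(x) dx`. -/
def momE (N : ℕ) (α : Fin N → ℕ) (f : EuclideanSpace ℝ (Fin N) → ℝ) : ℝ :=
  ∫ x, mpowE N α x * f x

/-- Auxiliary fuelled recursion computing the coefficients `M_α(f,t)`. -/
def McoefAux (N : ℕ) (G : EuclideanSpace ℝ (Fin N) → ℝ → ℝ)
    (f : EuclideanSpace ℝ (Fin N) → ℝ) (t : ℝ) : ℕ → (Fin N → ℕ) → ℝ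
  | 0, α => momE N α f
  | n + 1, α => momE N α f -
      ∑ β ∈ (Finset.Iic α).erase α,
        McoefAux N G f t n β * ∫ x, mpowE N α x * gA N G β x t

/-- `M_α(f,t)`, defined inductively on `|α|`:
`M_α(f,t) = ∫ x^α f dx - ∑_{β ≤ α, β ≠ α} M_β(f,t) ∫ x^α g_β(x,t) dx`. -/
def Mcoef (N : ℕ) (G : EuclideanSpace ℝ (Fin N) → ℝ → ℝ)
    (f : EuclideanSpace ℝ (Fin N) → ℝ) (t : ℝ) (α : Fin N → ℕ) : ℝ :=
  McoefAux N G f t (∑ i, α i) α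

/-- The finite set of multi-indices `α` with `|α| ≤ m`. -/
def multiIdx (N m : ℕ) : Finset (Fin N → ℕ) :=
  (Finset.Iic fun _ => m).filter fun α => ∑ i, α i ≤ m

/-- `P_K(t)f := f - ∑_{|α| ≤ K} M_α(f,t) g_α(·,t)`. -/
def PKop (N : ℕ) (G : EuclideanSpace ℝ (Fin N) → ℝ → ℝ) (K : ℝ) (t : ℝ)
    (f : EuclideanSpace ℝ (Fin N) → ℝ) : EuclideanSpace ℝ (Fin N) → ℝ :=
  fun x => f x - ∑ α ∈ multiIdx N ⌊K⌋₊, Mcoef N G f t α * gA N G α x t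

/-- The weighted `L¹` norm `|||φ|||_k = ∫ (1+|x|^k) ‖φ(x)‖ dx`, valued in `ℝ≥0∞`. -/
def wnorm (N : ℕ) {E' : Type*} [NormedAddCommGroup E'] (k : ℝ)
    (φ : EuclideanSpace ℝ (Fin N) → E') : ℝ≥0∞ :=
  ∫⁻ x, ENNReal.ofReal ((1 + ‖x‖ ^ k) * ‖φ x‖)

/-- Membership in `L¹_k = L¹(ℝ^N, (1+|x|^k)dx)`. -/
def MemL1k (N : ℕ) (k : ℝ) (φ : EuclideanSpace ℝ (Fin N) → ℝ) : Prop :=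
  AEStronglyMeasurable φ (volume : Measure (EuclideanSpace ℝ (Fin N))) ∧ wnorm N k φ < ⊤

/-- `E_{K,q}[f](t) = (1+t)^{K/d}[t^{(N/d)(1-1/q)} ‖f(t)‖_q + ‖f(t)‖_1] + |||f(t)|||_K`. -/
def Efun (N : ℕ) (d K : ℝ) (q : ℝ≥0∞) (f : EuclideanSpace ℝ (Fin N) → ℝ → ℝ) (t : ℝ) :
    ℝ≥0∞ :=
  ENNReal.ofReal ((1 + t) ^ (K / d)) *
      (ENNReal.ofReal (t ^ (((N : ℝ) / d) * (1 - q.toReal⁻¹))) *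
          eLpNorm (fun x => f x t) q volume +
        eLpNorm (fun x => f x t) 1 volume) +
    wnorm N K (fun x => f x t)

/-- `t^{(N/d)(1-1/q)} ‖w(t)‖_q + t^{-ℓ/d} |||w(t)|||_ℓ`. -/
def DistQ (N : ℕ) (d : ℝ) (q : ℝ≥0∞) (ℓ : ℝ) (w : EuclideanSpace ℝ (Fin N) → ℝ → ℝ)
    (t : ℝ) : ℝ≥0∞ :=
  ENNReal.ofReal (t ^ (((N : ℝ) / d) * (1 - q.toReal⁻¹))) * eLpNorm (fun x => w x t) q volume +
    ENNReal.ofReal (t ^ (-ℓ / d)) * wnorm N ℓ (fun x => w x t)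

end

/-- Iterated directional derivatives along the coordinates listed in `l`. -/
noncomputable def listDeriv (N : ℕ) (l : List (Fin N)) (h : EuclideanSpace ℝ (Fin N) → ℝ) :
    EuclideanSpace ℝ (Fin N) → ℝ :=
  l.foldr (pderivE N) h

theorem foldr_replicate_pderivE (N k : ℕ) (i : Fin N) (h : EuclideanSpace ℝ (Fin N) → ℝ) :
    (List.replicate k i).foldr (pderivE N) h = (pderivE N i)^[k] h := by
  induction k with
  | zero => rfl
  | succ k ih =>
    rw [List.replicate_succ, List.foldr_cons, ih, Function.iterate_succ_apply']

theorem mderivE_eq_listDeriv (N : ℕ) (α : Fin N → ℕ) :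
    ∃ l : List (Fin N), l.length = ∑ i, α i ∧ ∀ h, mderivE N α h = listDeriv N l h := by
  refine ⟨(List.ofFn fun i => List.replicate (α i) i).flatten, ?_, fun h => ?_⟩
  · simp [List.length_flatten, List.map_ofFn, Function.comp_def, List.sum_ofFn]
  · have key : ∀ l : List (Fin N),
        (l.map fun i => (pderivE N i)^[α i]).foldr (fun T h => T h) h =
          (l.map fun i => List.replicate (α i) i).flatten.foldr (pderivE N) h := by
      intro l
      induction l with
      | nil => rfl
      | cons i l ih =>
        simp only [List.map_cons, List.foldr_cons, List.flatten_cons, List.foldr_append]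
        rw [ih, foldr_replicate_pderivE]
    have := key (List.finRange N)
    simpa only [mderivE, listDeriv, List.ofFn_eq_map] using this

theorem listDeriv_eq_iteratedFDeriv (N : ℕ) (l : List (Fin N)) :
    ∃ v : Fin l.length → EuclideanSpace ℝ (Fin N), (∀ j, ‖v j‖ ≤ 1) ∧
      ∀ h : EuclideanSpace ℝ (Fin N) → ℝ, ContDiff ℝ l.length h →
        ∀ x, listDeriv N l h x = iteratedFDeriv ℝ l.length h x v := by
  induction l with
  | nil => exact ⟨Fin.elim0, fun j => j.elim0, fun h _ x => by simp [listDeriv]⟩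
  | cons i l ih =>
    obtain ⟨v, hv, hl⟩ := ih
    refine ⟨Fin.cons (EuclideanSpace.single i 1) v, fun j => ?_, fun h hh x => ?_⟩
    · refine Fin.cases ?_ (fun j => ?_) j
      · simp
      · simpa using hv j
    · have hlt : ((l.length : ℕ∞) : WithTop ℕ∞) < (((i :: l).length : ℕ∞) : WithTop ℕ∞) := by
        simp only [List.length_cons]
        exact_mod_cast Nat.lt_succ_self _
      have hfun : listDeriv N l h = fun y => iteratedFDeriv ℝ l.length h y v :=
        funext (hl h (hh.of_le hlt.le))
      have hd : DifferentiableAt ℝ (iteratedFDeriv ℝ l.length h) x :=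
        (hh.differentiable_iteratedFDeriv hlt) x
      change fderiv ℝ (listDeriv N l h) x (EuclideanSpace.single i 1) = _
      rw [hfun, fderiv_continuousMultilinear_apply_const_apply hd]
      exact (iteratedFDeriv_succ_apply_left (Fin.cons (EuclideanSpace.single i 1) v)).symm

theorem listDeriv_scaling (N : ℕ) (l : List (Fin N)) (h : EuclideanSpace ℝ (Fin N) → ℝ)
    (c a : ℝ) :
    listDeriv N l (fun x => c * h (a • x)) =
      fun x => c * a ^ l.length * listDeriv N l h (a • x) := by
  induction l with
  | nil => simp [listDeriv]
  | cons i l ih =>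
    funext x
    change fderiv ℝ (listDeriv N l fun x => c * h (a • x)) x (EuclideanSpace.single i 1) =
      c * a ^ (l.length + 1) * fderiv ℝ (listDeriv N l h) (a • x) (EuclideanSpace.single i 1)
    rw [ih]
    change fderiv ℝ ((c * a ^ l.length) • fun x => listDeriv N l h (a • x)) x _ = _
    rw [fderiv_const_smul_field]
    simp only [FunLike.coe_smul, Pi.smul_apply, fderiv_comp_smul, smul_eq_mul]
    ring

theorem mderivE_scaling (N : ℕ) (α : Fin N → ℕ) (h : EuclideanSpace ℝ (Fin N) → ℝ)
    (c a : ℝ) :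
    mderivE N α (fun x => c * h (a • x)) =
      fun x => c * a ^ (∑ i, α i) * mderivE N α h (a • x) := by
  obtain ⟨l, hl, hα⟩ := mderivE_eq_listDeriv N α
  rw [hα, hα, ← hl, listDeriv_scaling]

theorem continuous_mderivE (N : ℕ) (α : Fin N → ℕ) (h : EuclideanSpace ℝ (Fin N) → ℝ)
    (hh : ContDiff ℝ (∑ i, α i : ℕ) h) : Continuous (mderivE N α h) := by
  obtain ⟨l, hl, hα⟩ := mderivE_eq_listDeriv N α
  obtain ⟨v, -, hlv⟩ := listDeriv_eq_iteratedFDeriv N l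
  rw [← hl] at hh
  have : mderivE N α h = fun x => iteratedFDeriv ℝ l.length h x v := by
    rw [hα]; exact funext (hlv h hh)
  rw [this]
  exact (ContinuousMultilinearMap.apply ℝ _ ℝ v).continuous.comp
    (hh.continuous_iteratedFDeriv le_rfl)

theorem abs_mderivE_le (N : ℕ) (α : Fin N → ℕ) (h : EuclideanSpace ℝ (Fin N) → ℝ)
    (hh : ContDiff ℝ (∑ i, α i : ℕ) h) (x : EuclideanSpace ℝ (Fin N)) :
    |mderivE N α h x| ≤ ‖iteratedFDeriv ℝ (∑ i, α i) h x‖ := by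
  obtain ⟨l, hl, hα⟩ := mderivE_eq_listDeriv N α
  obtain ⟨v, hv, hlv⟩ := listDeriv_eq_iteratedFDeriv N l
  rw [← hl] at hh ⊢
  rw [hα, hlv h hh x, ← Real.norm_eq_abs]
  refine (ContinuousMultilinearMap.le_opNorm _ v).trans ?_
  exact mul_le_of_le_one_right (norm_nonneg _)
    (Finset.prod_le_one (fun j _ => norm_nonneg _) fun j _ => hv j)

theorem CondG.contDiff_one {N γ : ℕ} {d L : ℝ} {G : EuclideanSpace ℝ (Fin N) → ℝ → ℝ}
    (hG : CondG N G γ d L) : ContDiff ℝ γ fun y => G y 1 :=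
  contDiffOn_univ.1 (hG.smooth.comp (t := {p : EuclideanSpace ℝ (Fin N) × ℝ | 0 < p.2})
    (f := fun y => (y, (1 : ℝ))) (contDiff_id.prodMk contDiff_const).contDiffOn
      fun y _ => by simp)

theorem gA_scaling {N γ : ℕ} {d L : ℝ} {G : EuclideanSpace ℝ (Fin N) → ℝ → ℝ}
    (hG : CondG N G γ d L) (α : Fin N → ℕ) {t r : ℝ} (ht : 0 < t)
    (hr : r = (1 + t) ^ (1 / d)) (x : EuclideanSpace ℝ (Fin N)) :
    gA N G α x t = r ^ (-((N : ℝ) + (∑ i, α i : ℕ))) *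
      (((-1 : ℝ) ^ (∑ i, α i) / (mfactE N α : ℝ)) * mderivE N α (fun y => G y 1) (r⁻¹ • x)) := by
  have hs : 0 < 1 + t := by linarith
  have hr0 : 0 < r := hr ▸ Real.rpow_pos_of_pos hs _
  have e1 : (t + 1) ^ (-(N : ℝ) / d) = r ^ (-(N : ℝ)) := by
    rw [hr, ← Real.rpow_mul hs.le, add_comm]; congr 1; ring
  have e2 : (t + 1) ^ (-(1 : ℝ) / d) = r⁻¹ := by
    rw [hr, ← Real.rpow_neg hs.le, add_comm]; congr 1; ring
  have e3 : (fun y => G y (t + 1)) = fun y => r ^ (-(N : ℝ)) * G (r⁻¹ • y) 1 := by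
    funext y; rw [hG.scaling y (t + 1) (by linarith), e1, e2]
  rw [gA, e3, mderivE_scaling N α (fun y => G y 1), neg_add, Real.rpow_add hr0,
    Real.rpow_neg hr0.le ((∑ i, α i : ℕ) : ℝ), Real.rpow_natCast r (∑ i, α i), inv_pow]
  ring

theorem continuous_gA {N γ : ℕ} {d L : ℝ} {G : EuclideanSpace ℝ (Fin N) → ℝ → ℝ}
    (hG : CondG N G γ d L) {α : Fin N → ℕ} (hα : ∑ i, α i ≤ γ) {t : ℝ} (ht : 0 < t) :
    Continuous fun x => gA N G α x t := by
  have hc : Continuous (mderivE N α fun y => G y 1) :=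
    continuous_mderivE N α _ (hG.contDiff_one.of_le (by exact_mod_cast hα))
  rw [show (fun x => gA N G α x t) = _ from funext fun x => gA_scaling hG α ht rfl x]
  exact continuous_const.mul (continuous_const.mul (hc.comp (continuous_const_smul _)))

theorem abs_gA_le {N γ : ℕ} {d L : ℝ} {G : EuclideanSpace ℝ (Fin N) → ℝ → ℝ}
    (hG : CondG N G γ d L) {α : Fin N → ℕ} (hα : ∑ i, α i ≤ γ) :
    ∃ C : ℝ, 0 < C ∧ ∀ t r : ℝ, 0 < t → r = (1 + t) ^ (1 / d) → ∀ x,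
      |gA N G α x t| ≤ C * r ^ (-((N : ℝ) + (∑ i, α i : ℕ))) *
        (1 + ‖r⁻¹ • x‖) ^ (-((N : ℝ) + L)) := by
  obtain ⟨C, hC⟩ := hG.decay _ hα
  refine ⟨max C 1, by positivity, fun t r ht hr x => ?_⟩
  have hr0 : 0 < r := hr ▸ Real.rpow_pos_of_pos (by linarith) _
  set y := r⁻¹ • x
  have hy : 1 ≤ 1 + ‖y‖ := by linarith [norm_nonneg y]
  have hy0 : 0 < 1 + ‖y‖ := by linarith
  have h1 : |mderivE N α (fun y => G y 1) y| ≤ max C 1 * (1 + ‖y‖) ^ (-((N : ℝ) + L)) := by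
    refine (abs_mderivE_le N α _ (hG.contDiff_one.of_le (by exact_mod_cast hα)) y).trans ?_
    rw [Real.rpow_neg hy0.le, ← div_eq_mul_inv, le_div_iff₀ (by positivity), mul_comm]
    refine le_trans ?_ ((hC y).trans (le_max_left _ _))
    refine mul_le_mul_of_nonneg_right (Real.rpow_le_rpow_of_exponent_le hy ?_) (norm_nonneg _)
    exact le_add_of_nonneg_right (Nat.cast_nonneg _)
  have h2 : |(-1 : ℝ) ^ (∑ i, α i) / (mfactE N α : ℝ)| ≤ 1 := by
    rw [abs_div, abs_pow, abs_neg, abs_one, one_pow, Nat.abs_cast]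
    refine div_le_one_of_le₀ ?_ (Nat.cast_nonneg _)
    exact_mod_cast Nat.one_le_iff_ne_zero.2
      (Finset.prod_ne_zero_iff.2 fun i _ => Nat.factorial_ne_zero (α i))
  rw [gA_scaling hG α ht hr x, abs_mul, abs_mul, abs_of_pos (Real.rpow_pos_of_pos hr0 _)]
  calc _ ≤ r ^ (-((N : ℝ) + (∑ i, α i : ℕ))) *
        (1 * (max C 1 * (1 + ‖y‖) ^ (-((N : ℝ) + L)))) := by gcongr
    _ = _ := by ring

theorem lintegral_comp_inv_smul {N : ℕ} (F : EuclideanSpace ℝ (Fin N) → ℝ≥0∞)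
    (hF : Measurable F) {r : ℝ} (hr : 0 < r) :
    ∫⁻ x, F (r⁻¹ • x) = ENNReal.ofReal (r ^ N) * ∫⁻ y, F y := by
  have h := Measure.map_addHaar_smul (volume : Measure (EuclideanSpace ℝ (Fin N)))
    (inv_ne_zero hr.ne')
  rw [← lintegral_map hF (measurable_const_smul _), h, lintegral_smul_measure]
  simp [abs_of_pos hr]

theorem gA_sup_and_lintegral_weight_le {N γ : ℕ} {d L : ℝ} {G : EuclideanSpace ℝ (Fin N) → ℝ → ℝ}
    (hG : CondG N G γ d L) {α : Fin N → ℕ} (hα : ∑ i, α i ≤ γ) {K : ℝ} (hL : 0 < L) (hKL : K < L) :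
    ∃ C : ℝ, 0 < C ∧ ∀ t r : ℝ, 0 < t → r = (1 + t) ^ (1 / d) →
      (∀ x, |gA N G α x t| ≤ C * r ^ (-((N : ℝ) + (∑ i, α i : ℕ)))) ∧
      ∀ a ∈ Set.Icc 0 K, ∫⁻ x, ENNReal.ofReal (‖x‖ ^ a * |gA N G α x t|) ≤
        ENNReal.ofReal (C * r ^ (a - (∑ i, α i : ℕ))) := by
  obtain ⟨C, hC0, hC⟩ := abs_gA_le hG hα
  have hfin := finite_integral_one_add_norm (E := EuclideanSpace ℝ (Fin N))
    (μ := volume) (r := N + L - K) (by simp; linarith)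
  set I := ∫⁻ x : EuclideanSpace ℝ (Fin N), ENNReal.ofReal ((1 + ‖x‖) ^ (-(N + L - K)))
  have hI : I = ENNReal.ofReal I.toReal := (ENNReal.ofReal_toReal hfin.ne).symm
  refine ⟨C * (1 + I.toReal), by positivity, fun t r ht hr => ⟨fun x => ?_, fun a ha => ?_⟩⟩
  · have hr0 : 0 < r := hr ▸ Real.rpow_pos_of_pos (by linarith) _
    refine (hC t r ht hr x).trans ?_
    have h1 : (1 + ‖r⁻¹ • x‖) ^ (-((N : ℝ) + L)) ≤ 1 :=
      Real.rpow_le_one_of_one_le_of_nonpos (by linarith [norm_nonneg (r⁻¹ • x)])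
        (by linarith [(Nat.cast_nonneg N : (0 : ℝ) ≤ N)])
    have h2 : 0 ≤ C * r ^ (-((N : ℝ) + (∑ i, α i : ℕ))) := by positivity
    nlinarith [mul_nonneg h2 (ENNReal.toReal_nonneg : 0 ≤ I.toReal)]
  · have hr0 : 0 < r := hr ▸ Real.rpow_pos_of_pos (by linarith) _
    have hb : ∀ x, ENNReal.ofReal (‖x‖ ^ a * |gA N G α x t|) ≤
        ENNReal.ofReal (C * r ^ (a - N - (∑ i, α i : ℕ))) *
          ENNReal.ofReal ((1 + ‖r⁻¹ • x‖) ^ (-(N + L - K))) := by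
      intro x
      rw [← ENNReal.ofReal_mul (by positivity)]
      refine ENNReal.ofReal_le_ofReal ?_
      set y := r⁻¹ • x with hy
      have hx : ‖x‖ = r * ‖y‖ := by
        rw [hy, norm_smul, Real.norm_eq_abs, abs_of_pos (by positivity), mul_inv_cancel_left₀ hr0.ne']
      have hy1 : 1 ≤ 1 + ‖y‖ := by linarith [norm_nonneg y]
      have hy2 : ‖y‖ ^ a ≤ (1 + ‖y‖) ^ K :=
        (Real.rpow_le_rpow (norm_nonneg y) (by linarith) ha.1).trans
          (Real.rpow_le_rpow_of_exponent_le hy1 ha.2)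
      calc ‖x‖ ^ a * |gA N G α x t|
          ≤ (r ^ a * (1 + ‖y‖) ^ K) * (C * r ^ (-((N : ℝ) + (∑ i, α i : ℕ))) *
            (1 + ‖y‖) ^ (-((N : ℝ) + L))) := by
            gcongr
            · rw [hx, Real.mul_rpow hr0.le (norm_nonneg y)]
              gcongr
            · exact hC t r ht hr x
        _ = C * (r ^ a * r ^ (-((N : ℝ) + (∑ i, α i : ℕ)))) *
            ((1 + ‖y‖) ^ K * (1 + ‖y‖) ^ (-((N : ℝ) + L))) := by ring
        _ = _ := by
            rw [← Real.rpow_add hr0, ← Real.rpow_add (by linarith)]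
            congr 3 <;> ring
    refine (lintegral_mono hb).trans ?_
    rw [lintegral_const_mul _ (by fun_prop),
      lintegral_comp_inv_smul (fun y => ENNReal.ofReal ((1 + ‖y‖) ^ (-(N + L - K))))
        (by fun_prop) hr0]
    change _ * (_ * I) ≤ _
    rw [hI, ← ENNReal.ofReal_mul (by positivity), ← ENNReal.ofReal_mul (by positivity)]
    refine ENNReal.ofReal_le_ofReal ?_
    have : r ^ (a - (∑ i, α i : ℕ)) = r ^ (a - N - (∑ i, α i : ℕ)) * r ^ N := by
      rw [← Real.rpow_natCast r N, ← Real.rpow_add hr0]; congr 1; ring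
    rw [this]
    have h2 : 0 ≤ C * (r ^ (a - N - (∑ i, α i : ℕ)) * r ^ N) := by positivity
    rw [ENNReal.toReal_ofReal ENNReal.toReal_nonneg]
    nlinarith

theorem eLpNorm_le_of_bound_of_lintegral_le {E : Type*} [MeasurableSpace E] {μ : Measure E}
    {g : E → ℝ} {q : ℝ≥0∞} (hq : 1 ≤ q) {M A : ℝ} (hM : 0 ≤ M) (hA : 0 ≤ A)
    (hgM : ∀ x, |g x| ≤ M) (hgA : ∫⁻ x, ENNReal.ofReal |g x| ∂μ ≤ ENNReal.ofReal A) :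
    eLpNorm g q μ ≤ ENNReal.ofReal (M ^ (1 - q.toReal⁻¹) * A ^ q.toReal⁻¹) := by
  by_cases hqt : q = ⊤
  · subst hqt
    simp only [eLpNorm_exponent_top, ENNReal.toReal_top, inv_zero, sub_zero, Real.rpow_one,
      Real.rpow_zero, mul_one]
    refine (eLpNormEssSup_le_of_ae_bound (C := M) (ae_of_all _ hgM))
  have hp : 1 ≤ q.toReal := by
    simpa using (ENNReal.toReal_le_toReal ENNReal.one_ne_top hqt).2 hq
  have hp0 : 0 < q.toReal := by linarith
  set p := q.toReal
  rw [eLpNorm_eq_lintegral_rpow_enorm_toReal (by positivity) hqt]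
  have h1 : ∫⁻ x, ‖g x‖ₑ ^ p ∂μ ≤ ENNReal.ofReal (M ^ (p - 1) * A) := by
    calc ∫⁻ x, ‖g x‖ₑ ^ p ∂μ
        ≤ ∫⁻ x, ENNReal.ofReal (M ^ (p - 1)) * ENNReal.ofReal |g x| ∂μ := by
          refine lintegral_mono fun x => ?_
          rw [Real.enorm_eq_ofReal_abs, ENNReal.ofReal_rpow_of_nonneg (abs_nonneg _) hp0.le,
            ← ENNReal.ofReal_mul (by positivity)]
          refine ENNReal.ofReal_le_ofReal ?_
          rcases (abs_nonneg (g x)).eq_or_lt with h | h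
          · rw [← h, Real.zero_rpow hp0.ne', mul_zero]
          · have : |g x| ^ p = |g x| ^ (p - 1) * |g x| := by
              rw [← Real.rpow_add_one h.ne']; congr 1; ring
            rw [this]
            exact mul_le_mul_of_nonneg_right
              (Real.rpow_le_rpow h.le (hgM x) (by linarith)) h.le
      _ = ENNReal.ofReal (M ^ (p - 1)) * ∫⁻ x, ENNReal.ofReal |g x| ∂μ :=
          lintegral_const_mul' _ _ ENNReal.ofReal_ne_top
      _ ≤ _ := by
          rw [ENNReal.ofReal_mul (by positivity)]
          gcongr
  refine (ENNReal.rpow_le_rpow h1 (by positivity)).trans ?_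
  rw [ENNReal.ofReal_rpow_of_nonneg (by positivity) (by positivity), one_div,
    Real.mul_rpow (by positivity) hA, ← Real.rpow_mul hM]
  rw [sub_mul, mul_inv_cancel₀ hp0.ne', one_mul]

theorem rpow_le_add_rpow {y r a K : ℝ} (hy : 0 ≤ y) (hr : 0 < r) (ha : 0 ≤ a) (haK : a ≤ K) :
    y ^ a ≤ r ^ a + r ^ (a - K) * y ^ K := by
  rcases le_total y r with h | h
  · have := Real.rpow_le_rpow hy h ha
    have : 0 ≤ r ^ (a - K) * y ^ K := by positivity
    linarith
  · have hy0 : 0 < y := hr.trans_le h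
    have h1 : y ^ a = y ^ (a - K) * y ^ K := by rw [← Real.rpow_add hy0]; congr 1; ring
    have h2 : y ^ (a - K) ≤ r ^ (a - K) :=
      Real.rpow_le_rpow_of_nonpos hr h (by linarith)
    rw [h1]
    have h3 : 0 ≤ r ^ a := by positivity
    have h4 : y ^ (a - K) * y ^ K ≤ r ^ (a - K) * y ^ K := by gcongr
    linarith

theorem lintegral_weight_le {N : ℕ} {φ : EuclideanSpace ℝ (Fin N) → ℝ} (hφ : Measurable φ)
    {K r e : ℝ} (hr : 0 < r) (he : 0 ≤ e)
    (h1 : ∫⁻ x, ENNReal.ofReal |φ x| ≤ ENNReal.ofReal (r ^ (-K) * e))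
    (hK : wnorm N K φ ≤ ENNReal.ofReal e) {a : ℝ} (ha : a ∈ Set.Icc 0 K) :
    ∫⁻ x, ENNReal.ofReal (‖x‖ ^ a * |φ x|) ≤ ENNReal.ofReal (2 * r ^ (a - K) * e) := by
  calc ∫⁻ x, ENNReal.ofReal (‖x‖ ^ a * |φ x|)
      ≤ ∫⁻ x, (ENNReal.ofReal (r ^ a) * ENNReal.ofReal |φ x| +
          ENNReal.ofReal (r ^ (a - K)) * ENNReal.ofReal ((1 + ‖x‖ ^ K) * ‖φ x‖)) := by
        refine lintegral_mono fun x => ?_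
        rw [← ENNReal.ofReal_mul (by positivity), ← ENNReal.ofReal_mul (by positivity),
          ← ENNReal.ofReal_add (by positivity) (by positivity), Real.norm_eq_abs]
        refine ENNReal.ofReal_le_ofReal ?_
        have := mul_le_mul_of_nonneg_right
          (rpow_le_add_rpow (norm_nonneg x) hr ha.1 ha.2) (abs_nonneg (φ x))
        have h2 : 0 ≤ r ^ (a - K) * |φ x| := by positivity
        linarith
    _ = ENNReal.ofReal (r ^ a) * (∫⁻ x, ENNReal.ofReal |φ x|) +
          ENNReal.ofReal (r ^ (a - K)) * wnorm N K φ := by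
        rw [lintegral_add_left (by fun_prop), lintegral_const_mul' _ _ ENNReal.ofReal_ne_top,
          lintegral_const_mul' _ _ ENNReal.ofReal_ne_top, wnorm]
    _ ≤ ENNReal.ofReal (r ^ a) * ENNReal.ofReal (r ^ (-K) * e) +
          ENNReal.ofReal (r ^ (a - K)) * ENNReal.ofReal e := by gcongr
    _ = _ := by
        rw [← ENNReal.ofReal_mul (by positivity), ← ENNReal.ofReal_mul (by positivity),
          ← ENNReal.ofReal_add (by positivity) (by positivity), ← mul_assoc,
          ← Real.rpow_add hr]
        congr 1
        rw [← sub_eq_add_neg]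
        ring

theorem abs_mpowE_le {N : ℕ} (α : Fin N → ℕ) (x : EuclideanSpace ℝ (Fin N)) :
    |mpowE N α x| ≤ ‖x‖ ^ ((∑ i, α i : ℕ) : ℝ) := by
  rw [mpowE, Finset.abs_prod, Real.rpow_natCast, ← Finset.prod_pow_eq_pow_sum]
  refine Finset.prod_le_prod (fun i _ => abs_nonneg _) fun i _ => ?_
  rw [abs_pow]
  exact pow_le_pow_left₀ (abs_nonneg _) (PiLp.norm_apply_le x i) _

theorem abs_integral_mpowE_mul_le {N : ℕ} (α : Fin N → ℕ) (φ : EuclideanSpace ℝ (Fin N) → ℝ)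
    {B : ℝ} (hB : 0 ≤ B)
    (h : ∫⁻ x, ENNReal.ofReal (‖x‖ ^ ((∑ i, α i : ℕ) : ℝ) * |φ x|) ≤ ENNReal.ofReal B) :
    |∫ x, mpowE N α x * φ x| ≤ B := by
  rw [← ENNReal.ofReal_le_ofReal_iff hB, ← Real.enorm_eq_ofReal_abs]
  refine (enorm_integral_le_lintegral_enorm _).trans ((lintegral_mono fun x => ?_).trans h)
  rw [Real.enorm_eq_ofReal_abs, abs_mul]
  exact ENNReal.ofReal_le_ofReal
    (mul_le_mul_of_nonneg_right (abs_mpowE_le α x) (abs_nonneg _))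

/-- The coefficients of `PKop` inherit the decay of the moments of `φ`. -/
theorem abs_McoefAux_le {N : ℕ} {G : EuclideanSpace ℝ (Fin N) → ℝ → ℝ} {m : ℕ} {d K : ℝ}
    (hmK : (m : ℝ) ≤ K) {Cg : (Fin N → ℕ) → ℝ} (hCg0 : ∀ α, 0 ≤ Cg α)
    (hCg : ∀ α : Fin N → ℕ, ∑ i, α i ≤ m → ∀ t r : ℝ, 0 < t → r = (1 + t) ^ (1 / d) →
      ∀ a ∈ Set.Icc 0 K, ∫⁻ x, ENNReal.ofReal (‖x‖ ^ a * |gA N G α x t|) ≤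
        ENNReal.ofReal (Cg α * r ^ (a - (∑ i, α i : ℕ))))
    (n : ℕ) (α : Fin N → ℕ) (hα : ∑ i, α i ≤ m) :
    ∃ C : ℝ, 0 < C ∧ ∀ (φ : EuclideanSpace ℝ (Fin N) → ℝ) (t r e : ℝ), 0 < t →
      r = (1 + t) ^ (1 / d) → 0 ≤ e →
      (∀ a ∈ Set.Icc 0 K, ∫⁻ x, ENNReal.ofReal (‖x‖ ^ a * |φ x|) ≤
        ENNReal.ofReal (2 * r ^ (a - K) * e)) →
      |McoefAux N G φ t n α| ≤ C * r ^ ((∑ i, α i : ℕ) - K) * e := by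
  have hmem : ∀ β : Fin N → ℕ, ∑ i, β i ≤ m → ((∑ i, β i : ℕ) : ℝ) ∈ Set.Icc 0 K :=
    fun β hβ => ⟨Nat.cast_nonneg _, le_trans (by exact_mod_cast hβ) hmK⟩
  induction n generalizing α with
  | zero =>
    refine ⟨2, two_pos, fun φ t r e ht hr he h => ?_⟩
    have hr0 : 0 < r := hr ▸ Real.rpow_pos_of_pos (by linarith) _
    exact abs_integral_mpowE_mul_le α φ (by positivity) (h _ (hmem α hα))
  | succ n ih =>
    have hle : ∀ β ∈ (Finset.Iic α).erase α, ∑ i, β i ≤ m := fun β hβ =>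
      (Finset.sum_le_sum fun i _ => Finset.mem_Iic.1 (Finset.mem_of_mem_erase hβ) i).trans hα
    choose! c hc0 hc using fun β hβ => ih β hβ
    refine ⟨2 + ∑ β ∈ (Finset.Iic α).erase α, c β * Cg β,
      add_pos_of_pos_of_nonneg two_pos (Finset.sum_nonneg fun β hβ =>
        mul_nonneg (hc0 β (hle β hβ)).le (hCg0 β)), fun φ t r e ht hr he h => ?_⟩
    have hr0 : 0 < r := hr ▸ Real.rpow_pos_of_pos (by linarith) _
    rw [McoefAux, add_mul, add_mul, Finset.sum_mul, Finset.sum_mul]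
    refine (abs_sub _ _).trans (add_le_add ?_
      ((Finset.abs_sum_le_sum_abs _ _).trans (Finset.sum_le_sum fun β hβ => ?_)))
    · exact abs_integral_mpowE_mul_le α φ (by positivity) (h _ (hmem α hα))
    · have hβm := hle β hβ
      have h1 := hc β hβm φ t r e ht hr he h
      have h2 : |∫ x, mpowE N α x * gA N G β x t| ≤
          Cg β * r ^ (((∑ i, α i : ℕ) : ℝ) - (∑ i, β i : ℕ)) :=
        abs_integral_mpowE_mul_le α (fun x => gA N G β x t)
          (mul_nonneg (hCg0 β) (by positivity)) (hCg β hβm t r ht hr _ (hmem α hα))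
      rw [abs_mul]
      refine (mul_le_mul h1 h2 (abs_nonneg _) ((abs_nonneg _).trans h1)).trans (le_of_eq ?_)
      have : r ^ ((∑ i, α i : ℕ) - K) =
          r ^ ((∑ i, β i : ℕ) - K) * r ^ (((∑ i, α i : ℕ) : ℝ) - (∑ i, β i : ℕ)) := by
        rw [← Real.rpow_add hr0]; congr 1; ring
      rw [this]; ring

theorem wnorm_le_of_weight {N : ℕ} {ψ : EuclideanSpace ℝ (Fin N) → ℝ} (hψ : Measurable ψ)
    {K r D b : ℝ} (hr : 1 ≤ r) (hD : 0 ≤ D)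
    (h : ∀ a ∈ Set.Icc 0 K, ∫⁻ x, ENNReal.ofReal (‖x‖ ^ a * |ψ x|) ≤
      ENNReal.ofReal (D * r ^ (a - b)))
    {ℓ : ℝ} (hℓ : ℓ ∈ Set.Icc 0 K) :
    wnorm N ℓ ψ ≤ ENNReal.ofReal (2 * D * r ^ (ℓ - b)) := by
  have hr0 : 0 < r := by linarith
  have h0 := h 0 ⟨le_rfl, hℓ.1.trans hℓ.2⟩
  have h0' : D * r ^ (0 - b) ≤ D * r ^ (ℓ - b) :=
    mul_le_mul_of_nonneg_left
      (Real.rpow_le_rpow_of_exponent_le hr (by linarith [hℓ.1])) hD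
  calc wnorm N ℓ ψ = ∫⁻ x, (ENNReal.ofReal (‖x‖ ^ (0 : ℝ) * |ψ x|) +
        ENNReal.ofReal (‖x‖ ^ ℓ * |ψ x|)) := by
        refine lintegral_congr fun x => ?_
        rw [← ENNReal.ofReal_add (by positivity) (by positivity), Real.rpow_zero,
          Real.norm_eq_abs]
        congr 1
        ring
    _ = (∫⁻ x, ENNReal.ofReal (‖x‖ ^ (0 : ℝ) * |ψ x|)) +
        ∫⁻ x, ENNReal.ofReal (‖x‖ ^ ℓ * |ψ x|) := lintegral_add_left (by fun_prop) _
    _ ≤ ENNReal.ofReal (D * r ^ (ℓ - b)) + ENNReal.ofReal (D * r ^ (ℓ - b)) :=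
        add_le_add (h0.trans (ENNReal.ofReal_le_ofReal h0')) (h ℓ hℓ)
    _ = _ := by
        rw [← ENNReal.ofReal_add (by positivity) (by positivity)]
        congr 1
        ring

theorem wnorm_sub_sum_le {N : ℕ} {ι : Type*} (s : Finset ι) {k : ℝ}
    {φ : EuclideanSpace ℝ (Fin N) → ℝ} (hφ : Measurable φ) (c : ι → ℝ)
    {g : ι → EuclideanSpace ℝ (Fin N) → ℝ} (hg : ∀ i ∈ s, Measurable (g i)) :
    wnorm N k (fun x => φ x - ∑ i ∈ s, c i * g i x) ≤
      wnorm N k φ + ∑ i ∈ s, ENNReal.ofReal |c i| * wnorm N k (g i) := by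
  simp only [wnorm]
  have : ∑ i ∈ s, ENNReal.ofReal |c i| * ∫⁻ x, ENNReal.ofReal ((1 + ‖x‖ ^ k) * ‖g i x‖) =
      ∫⁻ x, ∑ i ∈ s, ENNReal.ofReal |c i| * ENNReal.ofReal ((1 + ‖x‖ ^ k) * ‖g i x‖) := by
    rw [lintegral_finsetSum' _ fun i hi => ?_]
    · exact Finset.sum_congr rfl fun i _ =>
        (lintegral_const_mul' _ _ ENNReal.ofReal_ne_top).symm
    · have := hg i hi
      fun_prop
  rw [this, ← lintegral_add_left (by fun_prop)]
  refine lintegral_mono fun x => ?_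
  simp_rw [← ENNReal.ofReal_mul (abs_nonneg _)]
  rw [← ENNReal.ofReal_sum_of_nonneg (fun i _ => by positivity),
    ← ENNReal.ofReal_add (by positivity) (Finset.sum_nonneg fun i _ => by positivity)]
  refine ENNReal.ofReal_le_ofReal ?_
  have h1 : ‖φ x - ∑ i ∈ s, c i * g i x‖ ≤ ‖φ x‖ + ∑ i ∈ s, |c i| * ‖g i x‖ := by
    refine (norm_sub_le _ _).trans (add_le_add le_rfl ((norm_sum_le _ _).trans (le_of_eq ?_)))
    exact Finset.sum_congr rfl fun i _ => by rw [norm_mul, Real.norm_eq_abs (c i)]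
  refine (mul_le_mul_of_nonneg_left h1 (by positivity)).trans (le_of_eq ?_)
  rw [mul_add, Finset.mul_sum]
  congr 1
  exact Finset.sum_congr rfl fun i _ => by ring

theorem eLpNorm_sub_sum_le {E ι : Type*} [MeasurableSpace E] {μ : Measure E} (s : Finset ι)
    {q : ℝ≥0∞} (hq : 1 ≤ q) {φ : E → ℝ} (hφ : Measurable φ) (c : ι → ℝ) {g : ι → E → ℝ}
    (hg : ∀ i ∈ s, Measurable (g i)) :
    eLpNorm (fun x => φ x - ∑ i ∈ s, c i * g i x) q μ ≤
      eLpNorm φ q μ + ∑ i ∈ s, ENNReal.ofReal |c i| * eLpNorm (g i) q μ := by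
  have hm : ∀ i ∈ s, AEStronglyMeasurable (c i • g i) μ := fun i hi =>
    ((hg i hi).aestronglyMeasurable).const_smul (c i)
  have he : (fun x => φ x - ∑ i ∈ s, c i * g i x) = φ - ∑ i ∈ s, c i • g i := by
    funext x
    simp
  rw [he]
  refine (eLpNorm_sub_le hφ.aestronglyMeasurable
    (Finset.aestronglyMeasurable_sum s hm) hq).trans (add_le_add le_rfl ?_)
  refine (eLpNorm_sum_le hm hq).trans (Finset.sum_le_sum fun i _ => ?_)
  rw [eLpNorm_const_smul, Real.enorm_eq_ofReal_abs]

theorem le_ofReal_of_rpow_mul_le {X : ℝ≥0∞} {r K e : ℝ} (hr : 0 < r)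
    (h : ENNReal.ofReal (r ^ K) * X ≤ ENNReal.ofReal e) :
    X ≤ ENNReal.ofReal (r ^ (-K) * e) := by
  calc X = ENNReal.ofReal (r ^ (-K)) * (ENNReal.ofReal (r ^ K) * X) := by
        rw [← mul_assoc, ← ENNReal.ofReal_mul (by positivity), ← Real.rpow_add hr]
        simp
    _ ≤ ENNReal.ofReal (r ^ (-K)) * ENNReal.ofReal e := by gcongr
    _ = _ := (ENNReal.ofReal_mul (by positivity)).symm

theorem weighted_eLpNorm_le_of_decay {N : ℕ} {g : EuclideanSpace ℝ (Fin N) → ℝ} {q : ℝ≥0∞} (hq : 1 ≤ q)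
    {d t r C a : ℝ} (hd : 0 < d) (ht : 0 < t) (hr : r = (1 + t) ^ (1 / d)) (hC : 0 ≤ C)
    (hsup : ∀ x, |g x| ≤ C * r ^ (-((N : ℝ) + a)))
    (hint : ∫⁻ x, ENNReal.ofReal |g x| ≤ ENNReal.ofReal (C * r ^ (-a))) :
    ENNReal.ofReal (t ^ (((N : ℝ) / d) * (1 - q.toReal⁻¹))) * eLpNorm g q volume ≤
      ENNReal.ofReal (C * r ^ (-a)) := by
  have hs : 0 < 1 + t := by linarith
  have hr0 : 0 < r := hr ▸ Real.rpow_pos_of_pos hs _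
  have hθ : 0 ≤ 1 - q.toReal⁻¹ := by
    rcases eq_or_ne q ⊤ with h | h
    · simp [h]
    · have : 1 ≤ q.toReal := by
        simpa using (ENNReal.toReal_le_toReal ENNReal.one_ne_top h).2 hq
      linarith [inv_le_one_of_one_le₀ this]
  have hθ' : (1 - q.toReal⁻¹) + q.toReal⁻¹ = 1 := by ring
  set θ := q.toReal⁻¹
  have hT : t ^ (((N : ℝ) / d) * (1 - θ)) ≤ r ^ ((N : ℝ) * (1 - θ)) := by
    rw [hr, ← Real.rpow_mul hs.le,
      show 1 / d * ((N : ℝ) * (1 - θ)) = (N : ℝ) / d * (1 - θ) by ring]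
    exact Real.rpow_le_rpow ht.le (by linarith) (by positivity)
  have hb := eLpNorm_le_of_bound_of_lintegral_le hq (by positivity) (by positivity) hsup hint
  have hb' : (C * r ^ (-((N : ℝ) + a))) ^ (1 - θ) * (C * r ^ (-a)) ^ θ =
      C * r ^ (-((N : ℝ) * (1 - θ)) - a) := by
    rw [Real.mul_rpow hC (by positivity), Real.mul_rpow hC (by positivity),
      ← Real.rpow_mul hr0.le, ← Real.rpow_mul hr0.le]
    calc _ = (C ^ (1 - θ) * C ^ θ) * (r ^ (-((N : ℝ) + a) * (1 - θ)) * r ^ (-a * θ)) := by ring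
      _ = _ := by
        rw [← Real.rpow_add' hC (by rw [hθ']; exact one_ne_zero), ← Real.rpow_add hr0, hθ',
          Real.rpow_one]
        congr 2
        ring
  rw [hb'] at hb
  refine (mul_le_mul' (ENNReal.ofReal_le_ofReal hT) hb).trans (le_of_eq ?_)
  rw [← ENNReal.ofReal_mul (by positivity)]
  congr 1
  rw [mul_left_comm, ← Real.rpow_add hr0]
  congr 2
  ring

/-- Lemma 2.2, third part: for `ℓ ∈ [0,K]` there is `C` with
`t^{(N/d)(1-1/q)}‖P_K(t)f(t)‖_q + (1+t)^{-ℓ/d}|||P_K(t)f(t)|||_ℓ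
  ≤ C (1+t)^{-K/d} E_{K,q}[f](t)` for a.e. `t > 0`. -/
theorem stmt12 (N γ : ℕ) (hN : 1 ≤ N) (d L : ℝ) (hd : 0 < d) (hL : 0 < L)
    (G : EuclideanSpace ℝ (Fin N) → ℝ → ℝ) (hG : CondG N G γ d L)
    (K : ℝ) (hK0 : 0 ≤ K) (hKL : K < L) (hKγ : ⌈K⌉₊ + 1 ≤ γ)
    (q : ℝ≥0∞) (hq : 1 ≤ q)
    (f : EuclideanSpace ℝ (Fin N) → ℝ → ℝ)
    (hf : Measurable fun p : EuclideanSpace ℝ (Fin N) × ℝ => f p.1 p.2)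
    (hE : ∀ T : ℝ, 0 < T → ∃ C : ℝ,
      ∀ᵐ t ∂(volume.restrict (Set.Ioo (0 : ℝ) T)), Efun N d K q f t ≤ ENNReal.ofReal C)
    (ℓ : ℝ) (hℓ : ℓ ∈ Set.Icc 0 K) :
    ∃ C : ℝ, 0 < C ∧
      ∀ᵐ t ∂(volume.restrict (Set.Ioi (0 : ℝ))),
        ENNReal.ofReal (t ^ (((N : ℝ) / d) * (1 - q.toReal⁻¹))) *
            eLpNorm (fun x => PKop N G K t (fun z => f z t) x) q volume +
          ENNReal.ofReal ((1 + t) ^ (-ℓ / d)) *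
            wnorm N ℓ (fun x => PKop N G K t (fun z => f z t) x) ≤
        ENNReal.ofReal (C * (1 + t) ^ (-K / d)) * Efun N d K q f t := by
  have hm : ((⌊K⌋₊ : ℕ) : ℝ) ≤ K := Nat.floor_le hK0
  have hmγ : ⌊K⌋₊ ≤ γ := (Nat.floor_le_ceil K).trans (by omega)
  have hex : ∀ α : Fin N → ℕ, ∃ C : ℝ, 0 < C ∧ (∑ i, α i ≤ ⌊K⌋₊ →
      ∀ t r : ℝ, 0 < t → r = (1 + t) ^ (1 / d) →
      (∀ x, |gA N G α x t| ≤ C * r ^ (-((N : ℝ) + (∑ i, α i : ℕ)))) ∧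
      ∀ a ∈ Set.Icc 0 K, ∫⁻ x, ENNReal.ofReal (‖x‖ ^ a * |gA N G α x t|) ≤
        ENNReal.ofReal (C * r ^ (a - (∑ i, α i : ℕ)))) := by
    intro α
    by_cases hα : ∑ i, α i ≤ ⌊K⌋₊
    · obtain ⟨C, hC0, hC⟩ := gA_sup_and_lintegral_weight_le hG (hα.trans hmγ) hL hKL
      exact ⟨C, hC0, fun _ => hC⟩
    · exact ⟨1, one_pos, fun h => absurd h hα⟩
  choose Cg hCg0 hCg using hex
  choose! c hc0 hc using fun α hα => abs_McoefAux_le (G := G) hm (fun α => (hCg0 α).le)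
    (fun α hα t r ht hr => (hCg α hα t r ht hr).2) (∑ i, α i) α hα
  have hidx : ∀ α ∈ multiIdx N ⌊K⌋₊, ∑ i, α i ≤ ⌊K⌋₊ := fun α hα =>
    (Finset.mem_filter.1 hα).2
  set S := ∑ α ∈ multiIdx N ⌊K⌋₊, c α * Cg α with hS
  have hS0 : 0 ≤ S := Finset.sum_nonneg fun α hα =>
    mul_nonneg (hc0 α (hidx α hα)).le (hCg0 α).le
  refine ⟨5 + 3 * S, by positivity, ?_⟩
  filter_upwards [ae_restrict_mem measurableSet_Ioi] with t ht
  replace ht : 0 < t := ht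
  have hs : 0 < 1 + t := by linarith
  by_cases hEt : Efun N d K q f t = ⊤
  · rw [hEt, ENNReal.mul_top]
    · exact le_top
    · exact (ENNReal.ofReal_pos.2 (by positivity)).ne'
  obtain ⟨r, hr⟩ : ∃ r, r = (1 + t) ^ (1 / d) := ⟨_, rfl⟩
  have hpow : ∀ b : ℝ, (1 + t) ^ (b / d) = r ^ b := fun b => by
    rw [hr, ← Real.rpow_mul hs.le]; congr 1; ring
  have hr1 : 1 ≤ r := hr ▸ Real.one_le_rpow (by linarith) (by positivity)
  have hr0 : 0 < r := by linarith
  obtain ⟨e, he⟩ : ∃ e, e = (Efun N d K q f t).toReal := ⟨_, rfl⟩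
  have he0 : 0 ≤ e := he ▸ ENNReal.toReal_nonneg
  have hEe : Efun N d K q f t = ENNReal.ofReal e := by rw [he, ENNReal.ofReal_toReal hEt]
  rw [hEe, hpow, hpow, ← ENNReal.ofReal_mul (by positivity)]
  obtain ⟨φ, hφ⟩ : ∃ φ : EuclideanSpace ℝ (Fin N) → ℝ, φ = fun z => f z t := ⟨_, rfl⟩
  have hφm : Measurable φ := hφ ▸ hf.comp (by fun_prop : Measurable fun z => (z, t))
  rw [Efun, hpow, ← hφ, mul_add] at hEe
  rw [← hφ]
  set T := ENNReal.ofReal (t ^ (((N : ℝ) / d) * (1 - q.toReal⁻¹))) with hT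
  have hq' : T * eLpNorm φ q volume ≤ ENNReal.ofReal (r ^ (-K) * e) :=
    le_ofReal_of_rpow_mul_le hr0 (hEe ▸ le_self_add.trans le_self_add)
  have h1' : ∫⁻ x, ENNReal.ofReal |φ x| ≤ ENNReal.ofReal (r ^ (-K) * e) := by
    have : eLpNorm φ 1 volume ≤ ENNReal.ofReal (r ^ (-K) * e) :=
      le_ofReal_of_rpow_mul_le hr0 (hEe ▸ le_add_self.trans le_self_add)
    simpa only [eLpNorm_one_eq_lintegral_enorm, Real.enorm_eq_ofReal_abs] using this
  have hw' : wnorm N K φ ≤ ENNReal.ofReal e := hEe ▸ le_add_self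
  have hmom : ∀ a ∈ Set.Icc 0 K, ∫⁻ x, ENNReal.ofReal (‖x‖ ^ a * |φ x|) ≤
      ENNReal.ofReal (2 * r ^ (a - K) * e) := fun a ha =>
    lintegral_weight_le hφm hr0 he0 h1' hw' ha
  have hM : ∀ α ∈ multiIdx N ⌊K⌋₊,
      |Mcoef N G φ t α| ≤ c α * r ^ ((∑ i, α i : ℕ) - K) * e := fun α hα =>
    hc α (hidx α hα) φ t r e ht hr he0 hmom
  have hgm : ∀ α ∈ multiIdx N ⌊K⌋₊, Measurable fun x => gA N G α x t := fun α hα =>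
    (continuous_gA hG ((hidx α hα).trans hmγ) ht).measurable
  have hsum : ∀ (κ b : ℝ), 0 ≤ κ → ∀ F : (Fin N → ℕ) → ℝ≥0∞,
      (∀ α ∈ multiIdx N ⌊K⌋₊,
        F α ≤ ENNReal.ofReal (κ * Cg α * r ^ (b - (∑ i, α i : ℕ)))) →
      ∑ α ∈ multiIdx N ⌊K⌋₊, ENNReal.ofReal |Mcoef N G φ t α| * F α ≤
        ENNReal.ofReal (κ * S * r ^ (b - K) * e) := by
    intro κ b hκ F hF
    have hrw : κ * S * r ^ (b - K) * e =
        ∑ α ∈ multiIdx N ⌊K⌋₊, κ * (c α * Cg α) * r ^ (b - K) * e := by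
      rw [hS, Finset.mul_sum, Finset.sum_mul, Finset.sum_mul]
    have hnn : ∀ α ∈ multiIdx N ⌊K⌋₊, 0 ≤ κ * (c α * Cg α) * r ^ (b - K) * e := fun α hα => by
      have := (hc0 α (hidx α hα)).le
      have := (hCg0 α).le
      positivity
    rw [hrw, ENNReal.ofReal_sum_of_nonneg hnn]
    refine Finset.sum_le_sum fun α hα => ?_
    refine (mul_le_mul' (ENNReal.ofReal_le_ofReal (hM α hα)) (hF α hα)).trans (le_of_eq ?_)
    rw [← ENNReal.ofReal_mul ((abs_nonneg _).trans (hM α hα))]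
    congr 1
    have : r ^ (b - K) = r ^ ((∑ i, α i : ℕ) - K) * r ^ (b - (∑ i, α i : ℕ)) := by
      rw [← Real.rpow_add hr0]; congr 1; ring
    rw [this]
    ring
  have hA : T * eLpNorm (fun x => PKop N G K t φ x) q volume ≤
      ENNReal.ofReal ((1 + S) * r ^ (-K) * e) := by
    refine (mul_le_mul_right (eLpNorm_sub_sum_le (multiIdx N ⌊K⌋₊) hq hφm
      (fun α => Mcoef N G φ t α) (g := fun α x => gA N G α x t) hgm) T).trans ?_
    rw [mul_add, Finset.mul_sum]
    simp_rw [mul_left_comm T]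
    refine (add_le_add hq' (hsum 1 0 zero_le_one _ fun α hα => ?_)).trans (le_of_eq ?_)
    · rw [one_mul, zero_sub]
      have hg := hCg α (hidx α hα) t r ht hr
      refine weighted_eLpNorm_le_of_decay hq hd ht hr (hCg0 α).le hg.1 ?_
      simpa using hg.2 0 ⟨le_rfl, hK0⟩
    · rw [← ENNReal.ofReal_add (by positivity) (by positivity), zero_sub]
      congr 1
      ring
  have hB : ENNReal.ofReal (r ^ (-ℓ)) * wnorm N ℓ (fun x => PKop N G K t φ x) ≤
      ENNReal.ofReal ((4 + 2 * S) * r ^ (-K) * e) := by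
    have h4 : wnorm N ℓ φ ≤ ENNReal.ofReal (2 * (2 * e) * r ^ (ℓ - K)) :=
      wnorm_le_of_weight hφm hr1 (by positivity)
        (fun a ha => (hmom a ha).trans (le_of_eq (by congr 1; ring))) hℓ
    have h5 : wnorm N ℓ (fun x => PKop N G K t φ x) ≤
        ENNReal.ofReal (2 * (2 * e) * r ^ (ℓ - K)) +
          ENNReal.ofReal (2 * S * r ^ (ℓ - K) * e) :=
      (wnorm_sub_sum_le (multiIdx N ⌊K⌋₊) hφm (fun α => Mcoef N G φ t α)
        (g := fun α x => gA N G α x t) hgm).trans (add_le_add h4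
          (hsum 2 ℓ zero_le_two _ fun α hα => wnorm_le_of_weight (hgm α hα) hr1 (hCg0 α).le
            (hCg α (hidx α hα) t r ht hr).2 hℓ))
    refine (mul_le_mul_right h5 _).trans (le_of_eq ?_)
    rw [← ENNReal.ofReal_add (by positivity) (by positivity),
      ← ENNReal.ofReal_mul (by positivity)]
    congr 1
    have : r ^ (-K) = r ^ (-ℓ) * r ^ (ℓ - K) := by
      rw [← Real.rpow_add hr0]; congr 1; ring
    rw [this]
    ring
  refine (add_le_add hA hB).trans (le_of_eq ?_)
  rw [← ENNReal.ofReal_add (by positivity) (by positivity)]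
  congr 1
  ring
end

section
/- Assume condition (G) for some γ ∈ ℕ, d > 0 and L > 0. Let 0 ≤ k < L with [k]+1 ≤ γ, let j ∈ {0,…,γ}, and let ℓ ∈ [0,k]. Then there exists a constant C₁ such that for all t > 0 and all φ ∈ L¹_k: ∫_{ℝ^N} |x|^ℓ |∇^j (e^{tℒ}φ)(x)| dx ≤ C₁ t^{−(j−ℓ)/d} ∫_{ℝ^N} |φ(x)| dx + C₁ t^{−j/d} ∫_{ℝ^N} |x|^ℓ |φ(x)| dx. -/
open MeasureTheory Filter Asymptotics Topology
open scoped ENNReal BigOperators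

section ConvolutionBounds

variable {E F : Type*} [NormedAddCommGroup E] [NormedSpace ℝ E] [MeasurableSpace E] [BorelSpace E]
  [FiniteDimensional ℝ E] [NormedAddCommGroup F] [NormedSpace ℝ F] {μ : Measure E}

theorem integrable_smul_comp_sub {f : E → F} (hf : Continuous f) {C : ℝ} (hC : ∀ x, ‖f x‖ ≤ C)
    {φ : E → ℝ} (hφ : Integrable φ μ) (x : E) :
    Integrable (fun y => φ y • f (x - y)) μ := by
  refine (hφ.norm.mul_const C).mono'
    (hφ.1.smul (hf.comp (continuous_const.sub continuous_id)).aestronglyMeasurable) ?_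
  filter_upwards with y
  rw [norm_smul]
  gcongr
  exact hC _

theorem hasFDerivAt_integral_smul_comp_sub {f : E → F} (hf : ContDiff ℝ 1 f) {C C' : ℝ}
    (hC : ∀ x, ‖f x‖ ≤ C) (hC' : ∀ x, ‖fderiv ℝ f x‖ ≤ C')
    {φ : E → ℝ} (hφ : Integrable φ μ) (x : E) :
    HasFDerivAt (fun x => ∫ y, φ y • f (x - y) ∂μ) (∫ y, φ y • fderiv ℝ f (x - y) ∂μ) x := by
  have hf' : Continuous (fderiv ℝ f) := hf.continuous_fderiv one_ne_zero
  refine hasFDerivAt_integral_of_dominated_of_fderiv_le (s := Set.univ)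
    (bound := fun y => ‖φ y‖ * C') (F' := fun x y => φ y • fderiv ℝ f (x - y)) Filter.univ_mem
    (Filter.Eventually.of_forall fun z => (integrable_smul_comp_sub hf.continuous hC hφ z).1)
    (integrable_smul_comp_sub hf.continuous hC hφ x)
    (integrable_smul_comp_sub hf' hC' hφ x).1 ?_ (hφ.norm.mul_const C') ?_
  · filter_upwards with y z _
    rw [norm_smul]
    gcongr
    exact hC' _
  · filter_upwards with y z _
    have h := ((hf.differentiable one_ne_zero) (z - y)).hasFDerivAt.comp z
      ((hasFDerivAt_id z).sub_const y)
    exact h.const_smul (φ y)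

theorem iteratedFDeriv_integral_smul_comp_sub {f : E → F} {n : ℕ} (hf : ContDiff ℝ n f)
    (hb : ∀ i ≤ n, ∃ C, ∀ x, ‖iteratedFDeriv ℝ i f x‖ ≤ C)
    {φ : E → ℝ} (hφ : Integrable φ μ) {j : ℕ} (hj : j ≤ n) :
    iteratedFDeriv ℝ j (fun x => ∫ y, φ y • f (x - y) ∂μ) =
      fun x => ∫ y, φ y • iteratedFDeriv ℝ j f (x - y) ∂μ := by
  induction j with
  | zero =>
    ext1 x
    rw [iteratedFDeriv_zero_eq_comp, Function.comp_apply]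
    simp only [iteratedFDeriv_zero_eq_comp, Function.comp_apply, ← map_smul]
    exact (((continuousMultilinearCurryFin0 ℝ E F).symm.toContinuousLinearEquiv
      ).integral_comp_comm _).symm
  | succ j ih =>
    obtain ⟨C, hC⟩ := hb j (by omega)
    obtain ⟨C', hC'⟩ := hb (j + 1) hj
    have hd : ContDiff ℝ 1 (iteratedFDeriv ℝ j f) :=
      hf.iteratedFDeriv_right (by exact_mod_cast (by omega : 1 + j ≤ n))
    ext1 x
    rw [iteratedFDeriv_succ_eq_comp_left, Function.comp_apply, ih (by omega),
      (hasFDerivAt_integral_smul_comp_sub hd hC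
        (fun x => norm_fderiv_iteratedFDeriv.trans_le (hC' x)) hφ x).fderiv]
    simp only [iteratedFDeriv_succ_eq_comp_left, Function.comp_apply, ← map_smul]
    exact (ContinuousLinearEquiv.integral_comp_comm (𝕜 := ℝ) (μ := μ)
      (E := E →L[ℝ] ContinuousMultilinearMap ℝ (fun _ : Fin j => E) F)
      (F := ContinuousMultilinearMap ℝ (fun _ : Fin (j + 1) => E) F)
      ((continuousMultilinearCurryLeftEquiv ℝ (fun _ : Fin (j + 1) => E) F
        ).symm.toContinuousLinearEquiv)
      (fun y => φ y • fderiv ℝ (iteratedFDeriv ℝ j f) (x - y))).symm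

theorem lintegral_comp_smul_of_pos [μ.IsAddHaarMeasure] {g : E → ℝ≥0∞} (hg : Measurable g)
    {r : ℝ} (hr : 0 < r) :
    ∫⁻ x, g (r • x) ∂μ = ENNReal.ofReal (r ^ Module.finrank ℝ E)⁻¹ * ∫⁻ x, g x ∂μ := by
  rw [← lintegral_map hg (measurable_const_smul r), Measure.map_addHaar_smul μ hr.ne',
    lintegral_smul_measure, abs_of_nonneg (by positivity), smul_eq_mul]

theorem lintegral_enorm_rpow_mul_lintegral_comp_sub_le [μ.IsAddHaarMeasure] {M ψ : E → ℝ≥0∞}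
    (hM : Measurable M) (hψ : AEMeasurable ψ μ) {p : ℝ} (hp : 0 ≤ p) :
    ∫⁻ x, ‖x‖ₑ ^ p * ∫⁻ y, ψ y * M (x - y) ∂μ ∂μ ≤
      2 ^ p * ((∫⁻ z, ‖z‖ₑ ^ p * M z ∂μ) * ∫⁻ y, ψ y ∂μ +
        (∫⁻ z, M z ∂μ) * ∫⁻ y, ‖y‖ₑ ^ p * ψ y ∂μ) := by
  have hM2 (x : E) : Measurable fun y => M (x - y) := hM.comp (measurable_id.const_sub x)
  have hint (y : E) : ∫⁻ x, ‖x‖ₑ ^ p * (ψ y * M (x - y)) ∂μ ≤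
      2 ^ p * ((∫⁻ z, ‖z‖ₑ ^ p * M z ∂μ) * ψ y + (∫⁻ z, M z ∂μ) * (‖y‖ₑ ^ p * ψ y)) := by
    calc ∫⁻ x, ‖x‖ₑ ^ p * (ψ y * M (x - y)) ∂μ
        = ∫⁻ z, ‖z + y‖ₑ ^ p * (ψ y * M z) ∂μ := by
          simpa using lintegral_sub_right_eq_self (μ := μ) (fun z => ‖z + y‖ₑ ^ p * (ψ y * M z)) y
      _ ≤ ∫⁻ z, 2 ^ p * (ψ y * (‖z‖ₑ ^ p * M z) + ψ y * ‖y‖ₑ ^ p * M z) ∂μ := by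
          refine lintegral_mono fun z => ?_
          calc ‖z + y‖ₑ ^ p * (ψ y * M z)
              ≤ (2 ^ p * (‖z‖ₑ ^ p + ‖y‖ₑ ^ p)) * (ψ y * M z) := by
                gcongr
                exact (ENNReal.rpow_le_rpow (enorm_add_le z y) hp).trans
                  (ENNReal.add_rpow_le_two_rpow_mul_rpow_add_rpow _ _ hp)
            _ = _ := by ring
      _ = _ := by
          rw [lintegral_const_mul _ (by fun_prop), lintegral_add_left (by fun_prop),
            lintegral_const_mul _ (by fun_prop), lintegral_const_mul _ hM]
          ring
  calc ∫⁻ x, ‖x‖ₑ ^ p * ∫⁻ y, ψ y * M (x - y) ∂μ ∂μ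
      = ∫⁻ x, ∫⁻ y, ‖x‖ₑ ^ p * (ψ y * M (x - y)) ∂μ ∂μ := by
        refine lintegral_congr fun x => ?_
        exact (lintegral_const_mul'' _ (hψ.mul (hM2 x).aemeasurable)).symm
    _ = ∫⁻ y, ∫⁻ x, ‖x‖ₑ ^ p * (ψ y * M (x - y)) ∂μ ∂μ := by
        refine lintegral_lintegral_swap ?_
        refine AEMeasurable.mul (by fun_prop) (AEMeasurable.mul hψ.comp_snd ?_)
        exact (hM.comp (measurable_fst.sub measurable_snd)).aemeasurable
    _ ≤ ∫⁻ y, 2 ^ p * ((∫⁻ z, ‖z‖ₑ ^ p * M z ∂μ) * ψ y +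
          (∫⁻ z, M z ∂μ) * (‖y‖ₑ ^ p * ψ y)) ∂μ := lintegral_mono hint
    _ = _ := by
        have h2 : AEMeasurable (fun y => ‖y‖ₑ ^ p * ψ y) μ := by fun_prop
        rw [lintegral_const_mul'' _ (by fun_prop), lintegral_add_left' (by fun_prop),
          lintegral_const_mul'' _ hψ, lintegral_const_mul'' _ h2]

end ConvolutionBounds

section Kernel

variable {N γ : ℕ} {d L : ℝ} {G : EuclideanSpace ℝ (Fin N) → ℝ → ℝ}

theorem CondG.contDiff (hG : CondG N G γ d L) {t : ℝ} (ht : 0 < t) :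
    ContDiff ℝ γ (fun x => G x t) :=
  hG.smooth.comp_contDiff (contDiff_id.prodMk contDiff_const) fun _ => ht

theorem CondG.measurable_enorm_iteratedFDeriv (hG : CondG N G γ d L) {t : ℝ} (ht : 0 < t) {i : ℕ}
    (hi : i ≤ γ) : Measurable fun x => ‖iteratedFDeriv ℝ i (fun y => G y t) x‖ₑ :=
  ((hG.contDiff ht).continuous_iteratedFDeriv (by exact_mod_cast hi)).enorm.measurable

theorem CondG.iteratedFDeriv_eq (hG : CondG N G γ d L) {t : ℝ} (ht : 0 < t) {i : ℕ} (hi : i ≤ γ)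
    (x : EuclideanSpace ℝ (Fin N)) :
    iteratedFDeriv ℝ i (fun y => G y t) x =
      (t ^ (-(1 : ℝ) / d)) ^ (N + i) •
        iteratedFDeriv ℝ i (fun y => G y 1) (t ^ (-(1 : ℝ) / d) • x) := by
  set r := t ^ (-(1 : ℝ) / d) with hr
  have hpow : t ^ (-(N : ℝ) / d) = r ^ N := by
    rw [hr, ← Real.rpow_natCast, ← Real.rpow_mul ht.le]
    congr 1
    ring
  have hfun : (fun y => G y t) = fun y => r ^ N • G (r • y) 1 := by
    ext y
    rw [hG.scaling y t ht, hpow, smul_eq_mul]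
  have h1 : ContDiff ℝ i (fun y => G y 1) := (hG.contDiff one_pos).of_le (by exact_mod_cast hi)
  have h2 : ContDiff ℝ i (fun y => G (r • y) 1) := h1.comp (contDiff_const_smul r)
  rw [hfun, iteratedFDeriv_const_smul_apply' h2.contDiffAt, iteratedFDeriv_comp_const_smul r h1,
    smul_smul, pow_add]

theorem CondG.norm_iteratedFDeriv_one_le (hG : CondG N G γ d L) {i : ℕ} (hi : i ≤ γ) :
    ∃ C, ∀ x, ‖iteratedFDeriv ℝ i (fun y => G y 1) x‖ ≤ C * (1 + ‖x‖) ^ (-((N : ℝ) + L + i)) := by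
  obtain ⟨C, hC⟩ := hG.decay i hi
  refine ⟨C, fun x => ?_⟩
  have h : 0 < 1 + ‖x‖ := by positivity
  rw [Real.rpow_neg h.le, ← div_eq_mul_inv, le_div_iff₀ (by positivity), mul_comm]
  exact hC x

theorem CondG.exists_norm_iteratedFDeriv_le (hG : CondG N G γ d L) (hL : 0 < L) {t : ℝ}
    (ht : 0 < t) {i : ℕ} (hi : i ≤ γ) :
    ∃ C, ∀ x, ‖iteratedFDeriv ℝ i (fun y => G y t) x‖ ≤ C := by
  obtain ⟨C, hC⟩ := hG.norm_iteratedFDeriv_one_le hi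
  have hC0 : 0 ≤ C := by simpa using (norm_nonneg _).trans (hC 0)
  refine ⟨|(t ^ (-(1 : ℝ) / d)) ^ (N + i)| * C, fun x => ?_⟩
  rw [hG.iteratedFDeriv_eq ht hi, norm_smul, Real.norm_eq_abs]
  gcongr
  refine (hC _).trans (mul_le_of_le_one_right hC0 ?_)
  exact Real.rpow_le_one_of_one_le_of_nonpos (by simp) (neg_nonpos.2 (by positivity))

theorem CondG.lintegral_rpow_mul_iteratedFDeriv_one_lt_top (hG : CondG N G γ d L) {i : ℕ}
    (hi : i ≤ γ) {p : ℝ} (hp : 0 ≤ p) (hpL : p < L) :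
    ∫⁻ x, ‖x‖ₑ ^ p * ‖iteratedFDeriv ℝ i (fun y => G y 1) x‖ₑ < ⊤ := by
  obtain ⟨C, hC⟩ := hG.norm_iteratedFDeriv_one_le hi
  have hC0 : 0 ≤ C := by simpa using (norm_nonneg _).trans (hC 0)
  have hint : Integrable (fun x : EuclideanSpace ℝ (Fin N) =>
      C * (1 + ‖x‖) ^ (-((N : ℝ) + L + i - p))) := by
    refine (integrable_one_add_norm ?_).const_mul C
    have : (0 : ℝ) ≤ i := i.cast_nonneg
    rw [finrank_euclideanSpace_fin]
    linarith
  refine lt_of_le_of_lt (lintegral_mono fun x => ?_) hint.2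
  rw [← enorm_norm x, ← Real.enorm_rpow_of_nonneg (norm_nonneg x) hp, ← ofReal_norm, ← ofReal_norm,
    ← ofReal_norm, ← ENNReal.ofReal_mul (norm_nonneg _)]
  refine ENNReal.ofReal_le_ofReal ?_
  have h : 0 < 1 + ‖x‖ := by positivity
  rw [Real.norm_of_nonneg (by positivity), Real.norm_of_nonneg (by positivity)]
  calc ‖x‖ ^ p * ‖iteratedFDeriv ℝ i (fun y => G y 1) x‖
      ≤ (1 + ‖x‖) ^ p * (C * (1 + ‖x‖) ^ (-((N : ℝ) + L + i))) := by
        gcongr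
        · linarith
        · exact hC x
    _ = C * ((1 + ‖x‖) ^ p * (1 + ‖x‖) ^ (-((N : ℝ) + L + i))) := by ring
    _ = _ := by
        rw [← Real.rpow_add h]
        congr 2
        ring

theorem CondG.lintegral_rpow_mul_iteratedFDeriv_eq (hG : CondG N G γ d L) {t : ℝ} (ht : 0 < t)
    {i : ℕ} (hi : i ≤ γ) {p : ℝ} (hp : 0 ≤ p) :
    ∫⁻ x, ‖x‖ₑ ^ p * ‖iteratedFDeriv ℝ i (fun y => G y t) x‖ₑ =
      ENNReal.ofReal (t ^ (-((i : ℝ) - p) / d)) *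
        ∫⁻ x, ‖x‖ₑ ^ p * ‖iteratedFDeriv ℝ i (fun y => G y 1) x‖ₑ := by
  set r := t ^ (-(1 : ℝ) / d) with hr
  have hr0 : 0 < r := Real.rpow_pos_of_pos ht _
  have hpt (x : EuclideanSpace ℝ (Fin N)) :
      ‖x‖ₑ ^ p * ‖iteratedFDeriv ℝ i (fun y => G y t) x‖ₑ =
        ENNReal.ofReal (r ^ (-p) * r ^ (N + i)) *
          (‖r • x‖ₑ ^ p * ‖iteratedFDeriv ℝ i (fun y => G y 1) (r • x)‖ₑ) := by
    rw [hG.iteratedFDeriv_eq ht hi, ← hr, enorm_smul, enorm_smul, ENNReal.mul_rpow_of_nonneg _ _ hp,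
      ← Real.enorm_rpow_of_nonneg hr0.le hp, Real.enorm_of_nonneg (by positivity),
      Real.enorm_of_nonneg (by positivity)]
    have h : ENNReal.ofReal (r ^ (-p) * r ^ (N + i)) * ENNReal.ofReal (r ^ p) =
        ENNReal.ofReal (r ^ (N + i)) := by
      rw [← ENNReal.ofReal_mul (by positivity), mul_right_comm, ← Real.rpow_add hr0]
      simp
    rw [← h]
    ring
  have hmeas : Measurable fun x : EuclideanSpace ℝ (Fin N) =>
      ‖x‖ₑ ^ p * ‖iteratedFDeriv ℝ i (fun y => G y 1) x‖ₑ :=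
    (measurable_enorm.pow_const p).mul (hG.measurable_enorm_iteratedFDeriv one_pos hi)
  simp only [hpt]
  rw [lintegral_const_mul' _ _ ENNReal.ofReal_ne_top,
    lintegral_comp_smul_of_pos hmeas hr0, ← mul_assoc, ← ENNReal.ofReal_mul (by positivity),
    finrank_euclideanSpace_fin]
  congr 2
  rw [pow_add, mul_assoc, mul_right_comm (r ^ N), mul_inv_cancel₀ (by positivity), one_mul,
    ← Real.rpow_natCast, ← Real.rpow_add hr0, hr, ← Real.rpow_mul ht.le]
  congr 1
  ring

theorem MemL1k.integrable_rpow_mul {k : ℝ} {φ : EuclideanSpace ℝ (Fin N) → ℝ}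
    (hφ : MemL1k N k φ) {p : ℝ} (hp : p ∈ Set.Icc 0 k) :
    Integrable (fun x => ‖x‖ ^ p * |φ x|) := by
  refine ⟨((measurable_norm.pow_const p).aestronglyMeasurable).mul hφ.1.norm,
    lt_of_le_of_lt (lintegral_mono fun x => ?_) hφ.2⟩
  rw [← ofReal_norm, Real.norm_of_nonneg (by positivity), Real.norm_eq_abs]
  refine ENNReal.ofReal_le_ofReal (mul_le_mul_of_nonneg_right ?_ (abs_nonneg _))
  have hk : 0 ≤ ‖x‖ ^ k := by positivity
  rcases le_total ‖x‖ 1 with h | h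
  · linarith [Real.rpow_le_one (norm_nonneg x) h hp.1]
  · linarith [Real.rpow_le_rpow_of_exponent_le h hp.2]

theorem MemL1k.integrable {k : ℝ} (hk : 0 ≤ k) {φ : EuclideanSpace ℝ (Fin N) → ℝ}
    (hφ : MemL1k N k φ) : Integrable φ := by
  refine (integrable_norm_iff hφ.1).1 ?_
  simpa using hφ.integrable_rpow_mul ⟨le_rfl, hk⟩

theorem CondG.enorm_iteratedFDeriv_sgOp_le (hG : CondG N G γ d L) (hL : 0 < L) {t : ℝ}
    (ht : 0 < t) {j : ℕ} (hj : j ≤ γ) {φ : EuclideanSpace ℝ (Fin N) → ℝ} (hφ : Integrable φ)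
    (x : EuclideanSpace ℝ (Fin N)) :
    ‖iteratedFDeriv ℝ j (fun y => sgOp N G t φ y) x‖ₑ ≤
      ∫⁻ y, ‖φ y‖ₑ * ‖iteratedFDeriv ℝ j (fun z => G z t) (x - y)‖ₑ := by
  have h : (fun y => sgOp N G t φ y) = fun x => ∫ y, φ y • (fun z => G z t) (x - y) := by
    ext x
    simp only [sgOp, smul_eq_mul, mul_comm]
  rw [h, iteratedFDeriv_integral_smul_comp_sub (hG.contDiff ht)
    (fun i hi => hG.exists_norm_iteratedFDeriv_le hL ht hi) hφ hj]
  simpa only [enorm_smul] using enorm_integral_le_lintegral_enorm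
    fun y => φ y • iteratedFDeriv ℝ j (fun z => G z t) (x - y)

end Kernel

/-- Proposition 3.1 (i): for `j ∈ {0,…,γ}` and `ℓ ∈ [0,k]` there is `C₁` with
`∫ |x|^ℓ |∇ʲ e^{tℒ}φ(x)| dx ≤ C₁ t^{-(j-ℓ)/d} ∫|φ| + C₁ t^{-j/d} ∫ |x|^ℓ |φ|`
for all `t > 0` and `φ ∈ L¹_k`. -/
theorem stmt13 (N γ : ℕ) (hN : 1 ≤ N) (d L : ℝ) (hd : 0 < d) (hL : 0 < L)
    (G : EuclideanSpace ℝ (Fin N) → ℝ → ℝ) (hG : CondG N G γ d L)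
    (k : ℝ) (hk0 : 0 ≤ k) (hkL : k < L) (hkγ : ⌈k⌉₊ + 1 ≤ γ)
    (j : ℕ) (hj : j ≤ γ) (ℓ : ℝ) (hℓ : ℓ ∈ Set.Icc 0 k) :
    ∃ C₁ : ℝ, 0 < C₁ ∧ ∀ t : ℝ, 0 < t →
      ∀ φ : EuclideanSpace ℝ (Fin N) → ℝ, MemL1k N k φ →
        (∫⁻ x, ENNReal.ofReal
            (‖x‖ ^ ℓ * ‖iteratedFDeriv ℝ j (fun y => sgOp N G t φ y) x‖)) ≤
          ENNReal.ofReal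
            (C₁ * t ^ (-((j : ℝ) - ℓ) / d) * ∫ x, |φ x|) +
          ENNReal.ofReal
            (C₁ * t ^ (-(j : ℝ) / d) * ∫ x, ‖x‖ ^ ℓ * |φ x|) := by
  obtain ⟨hℓ0, hℓk⟩ := hℓ
  set A : ℝ → ℝ≥0∞ := fun p =>
    ∫⁻ x, ‖x‖ₑ ^ p * ‖iteratedFDeriv ℝ j (fun y => G y 1) x‖ₑ
  have hAtop {p : ℝ} (hp : 0 ≤ p) (hpk : p ≤ k) : A p = ENNReal.ofReal (A p).toReal :=
    (ENNReal.ofReal_toReal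
      (hG.lintegral_rpow_mul_iteratedFDeriv_one_lt_top hj hp (hpk.trans_lt hkL)).ne).symm
  set a := (A ℓ).toReal with ha
  set b := (A 0).toReal with hb
  have ha0 : 0 ≤ a := ENNReal.toReal_nonneg
  have hb0 : 0 ≤ b := ENNReal.toReal_nonneg
  refine ⟨2 ^ ℓ * (a + b) + 1, by positivity, fun t ht φ hφ => ?_⟩
  have hφi : Integrable φ := hφ.integrable hk0
  have hφ1 : ∫⁻ y, ‖φ y‖ₑ = ENNReal.ofReal (∫ x, |φ x|) :=
    (ofReal_integral_norm_eq_lintegral_enorm hφi).symm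
  have hφℓ : ∫⁻ y, ‖y‖ₑ ^ ℓ * ‖φ y‖ₑ = ENNReal.ofReal (∫ x, ‖x‖ ^ ℓ * |φ x|) := by
    rw [ofReal_integral_eq_lintegral_ofReal (hφ.integrable_rpow_mul ⟨hℓ0, hℓk⟩)
      (Eventually.of_forall fun x => by positivity)]
    refine lintegral_congr fun x => ?_
    rw [ENNReal.ofReal_mul (by positivity), ← ENNReal.ofReal_rpow_of_nonneg (norm_nonneg x) hℓ0,
      ofReal_norm, Real.enorm_eq_ofReal_abs]
  have hM := hG.measurable_enorm_iteratedFDeriv ht hj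
  have hMℓ := hG.lintegral_rpow_mul_iteratedFDeriv_eq ht hj hℓ0
  have hM0 := hG.lintegral_rpow_mul_iteratedFDeriv_eq ht hj le_rfl
  change _ = _ * A ℓ at hMℓ
  change _ = _ * A 0 at hM0
  rw [hAtop hℓ0 hℓk, ← ha, ← ENNReal.ofReal_mul (by positivity)] at hMℓ
  rw [hAtop le_rfl hk0, ← hb, ← ENNReal.ofReal_mul (by positivity)] at hM0
  simp only [ENNReal.rpow_zero, one_mul, sub_zero] at hM0
  have hI1 : 0 ≤ ∫ x, |φ x| := integral_nonneg fun x => abs_nonneg _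
  have hIℓ : 0 ≤ ∫ x, ‖x‖ ^ ℓ * |φ x| := integral_nonneg fun x => by positivity
  calc ∫⁻ x, ENNReal.ofReal (‖x‖ ^ ℓ * ‖iteratedFDeriv ℝ j (fun y => sgOp N G t φ y) x‖)
      ≤ ∫⁻ x, ‖x‖ₑ ^ ℓ *
          ∫⁻ y, ‖φ y‖ₑ * ‖iteratedFDeriv ℝ j (fun z => G z t) (x - y)‖ₑ := by
        refine lintegral_mono fun x => ?_
        rw [ENNReal.ofReal_mul (by positivity),
          ← ENNReal.ofReal_rpow_of_nonneg (norm_nonneg x) hℓ0, ofReal_norm, ofReal_norm]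
        gcongr
        exact hG.enorm_iteratedFDeriv_sgOp_le hL ht hj hφi x
    _ ≤ 2 ^ ℓ * (ENNReal.ofReal (t ^ (-((j : ℝ) - ℓ) / d) * a) * ENNReal.ofReal (∫ x, |φ x|) +
          ENNReal.ofReal (t ^ (-(j : ℝ) / d) * b) *
            ENNReal.ofReal (∫ x, ‖x‖ ^ ℓ * |φ x|)) := by
        rw [← hφ1, ← hφℓ, ← hMℓ, ← hM0]
        exact lintegral_enorm_rpow_mul_lintegral_comp_sub_le hM hφi.1.enorm hℓ0
    _ = ENNReal.ofReal (2 ^ ℓ * (t ^ (-((j : ℝ) - ℓ) / d) * a * ∫ x, |φ x|)) +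
          ENNReal.ofReal (2 ^ ℓ * (t ^ (-(j : ℝ) / d) * b * ∫ x, ‖x‖ ^ ℓ * |φ x|)) := by
        have h2 : (2 : ℝ≥0∞) ^ ℓ = ENNReal.ofReal (2 ^ ℓ) := by
          rw [← ENNReal.ofReal_rpow_of_nonneg zero_le_two hℓ0, ENNReal.ofReal_ofNat]
        rw [h2, ← ENNReal.ofReal_mul (by positivity), ← ENNReal.ofReal_mul (by positivity), mul_add,
          ← ENNReal.ofReal_mul (by positivity), ← ENNReal.ofReal_mul (by positivity)]
    _ ≤ _ := by
        have key {s c I : ℝ} (hs : 0 ≤ s) (hc : c ≤ a + b) (hI : 0 ≤ I) :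
            2 ^ ℓ * (s * c * I) ≤ (2 ^ ℓ * (a + b) + 1) * s * I := by
          calc 2 ^ ℓ * (s * c * I) = 2 ^ ℓ * c * (s * I) := by ring
            _ ≤ (2 ^ ℓ * (a + b) + 1) * (s * I) := by
              gcongr
              linarith [mul_le_mul_of_nonneg_left hc (by positivity : (0 : ℝ) ≤ 2 ^ ℓ)]
            _ = _ := by ring
        exact add_le_add
          (ENNReal.ofReal_le_ofReal (key (by positivity) (le_add_of_nonneg_right hb0) hI1))
          (ENNReal.ofReal_le_ofReal (key (by positivity) (le_add_of_nonneg_left ha0) hIℓ))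
end
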